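/- Let I be a set supercomposition, A ⊂ ℕ a finite set with |A| = |(I_1 ∪ ⋯ ∪ I_k) \ {0}|, and σ an element of the finitary symmetric group S_∞. Then the quasisymmetrizing action in noncommuting variables in superspace satisfies σ · A^I = σ(A)^I, where σ(A) = {σ(a) : a ∈ A}. -/

import Mathlib

/-- A noncommutative superspace monomial: `S` records the θ-indices (taken in increasing
order) and `w` is the word of `x`-indices. -/
structure NCMon where
  S : Finset ℕ
  w : List ℕ
deriving DecidableEq

namespace NCMon

/-- The set of indices of a noncommutative superspace monomial. -/
def ind (u : NCMon) : Finset ℕ := u.S ∪ u.w.toFinset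

/-- The total degree of a noncommutative superspace monomial. -/
def deg (u : NCMon) : ℕ := u.S.card + u.w.length

end NCMon

/-- The rank of `a` in the finite set `A`: the number of elements of `A` that are `≤ a`. -/
def rk (A : Finset ℕ) (a : ℕ) : ℕ := (A.filter (· ≤ a)).card

/-- Standardization of a monomial: relabel its indices via the unique order-preserving
bijection `ind u → {1, …, k}`. -/
def NCMon.std (u : NCMon) : NCMon := ⟨u.S.image (rk u.ind), u.w.map (rk u.ind)⟩

/-- The set supercomposition `I(u)` associated with a monomial `u`: its `r`-th block
records the (1-indexed) positions of the `r`-th smallest index in the word, together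
with `0` whenever that index is a θ-index. -/
def NCMon.scomp (u : NCMon) : List (Finset ℕ) :=
  (List.range u.ind.card).map fun r₀ =>
    (((Finset.range u.w.length).filter fun t => rk u.ind (u.w.getD t 0) = r₀ + 1).image (· + 1))
      ∪ (if r₀ + 1 ∈ u.S.image (rk u.ind) then ({0} : Finset ℕ) else ∅)

/-- The monomial quasisymmetric function in noncommuting variables in superspace:
the indicator function of the monomials whose set supercomposition is `I`. -/
def Mfn (I : List (Finset ℕ)) : NCMon → ℚ := fun u => if u.scomp = I then 1 else 0

/-- Number of inversions between two θ-supports. -/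
def invST (S T : Finset ℕ) : ℕ := ((S ×ˢ T).filter fun p => p.2 < p.1).card

/-- The product of coefficient functions, induced by the signed monomial product
`(S,w)·(T,v) = 0` if `S ∩ T ≠ ∅` and `(-1)^{inv(S,T)} (S ∪ T, w·v)` otherwise. -/
def mulF (f g : NCMon → ℚ) : NCMon → ℚ := fun m =>
  ∑ k ∈ Finset.range (m.w.length + 1), ∑ S₁ ∈ m.S.powerset,
    (-1 : ℚ) ^ invST S₁ (m.S \ S₁) * f ⟨S₁, m.w.take k⟩ * g ⟨m.S \ S₁, m.w.drop k⟩

/-- Quasisymmetry in noncommuting variables in superspace: the coefficient of a monomial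
depends only on its standardization. -/
def QSymNC (f : NCMon → ℚ) : Prop := ∀ u v : NCMon, u.std = v.std → f u = f v

/-- Bounded degree. -/
def BddDeg (f : NCMon → ℚ) : Prop := ∃ N, ∀ u : NCMon, f u ≠ 0 → u.deg ≤ N

/-- The set of nonzero elements appearing in the blocks of a sequence of subsets. -/
def unionNZ (I : List (Finset ℕ)) : Finset ℕ := (I.foldr (· ∪ ·) ∅).erase 0

/-- A set supercomposition: a sequence of nonempty subsets of `{0, …, n}`, pairwise
intersecting in at most `{0}`, whose union minus `{0}` equals `{1, …, n}`. Blocks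
containing `0` are the fermionic blocks. -/
def IsSSC (I : List (Finset ℕ)) : Prop :=
  (∀ B ∈ I, B.Nonempty) ∧ I.Pairwise (fun B C => B ∩ C ⊆ {0}) ∧
    unionNZ I = Finset.Icc 1 (unionNZ I).card

/-- The quasisymmetrizing action in noncommuting variables in superspace of the simple
transposition `s_i` on monomials: in the associated pseudo set supercomposition (padded
with trailing empty blocks), the blocks in positions `i` and `i+1` are interchanged when
at least one of them is empty. -/
def sNC (i : ℕ) (u : NCMon) : NCMon :=
  if i ∉ u.ind ∨ i + 1 ∉ u.ind then
    ⟨u.S.image fun a => Equiv.swap i (i + 1) a, u.w.map fun a => Equiv.swap i (i + 1) a⟩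
  else u

lemma rk_image_of_strictMonoOn {A : Finset ℕ} {f : ℕ → ℕ} (hf : StrictMonoOn f (A : Set ℕ))
    {a : ℕ} (ha : a ∈ A) : rk (A.image f) (f a) = rk A a := by
  have h : (A.image f).filter (· ≤ f a) = (A.filter (· ≤ a)).image f := by
    rw [Finset.filter_image]
    congr 1
    exact Finset.filter_congr fun b hb => hf.le_iff_le hb ha
  rw [rk, rk, h, Finset.card_image_of_injOn (hf.injOn.mono (Finset.coe_subset.2 (Finset.filter_subset _ _)))]

lemma swap_succ_strictMonoOn {A : Finset ℕ} {i : ℕ} (h : i ∉ A ∨ i + 1 ∉ A) :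
    StrictMonoOn (fun a => Equiv.swap i (i + 1) a) (A : Set ℕ) := by
  intro a ha b hb hab
  have hne : ¬(a = i ∧ b = i + 1) := by
    rintro ⟨rfl, rfl⟩
    exact h.elim (· ha) (· hb)
  simp only [Equiv.swap_apply_def]
  split_ifs <;> omega

namespace NCMon

/-- The monomial obtained by relabelling all indices along `f`. -/
def relabel (f : ℕ → ℕ) (u : NCMon) : NCMon := ⟨u.S.image f, u.w.map f⟩

lemma ind_relabel (f : ℕ → ℕ) (u : NCMon) : (u.relabel f).ind = u.ind.image f := by
  ext a
  simp only [relabel, ind, Finset.mem_union, Finset.mem_image, List.mem_toFinset, List.mem_map]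
  grind

lemma scomp_relabel {f : ℕ → ℕ} {u : NCMon} (hf : StrictMonoOn f (u.ind : Set ℕ)) :
    (u.relabel f).scomp = u.scomp := by
  have hrk : ∀ a ∈ u.ind, rk (u.relabel f).ind (f a) = rk u.ind a := fun a ha => by
    rw [ind_relabel, rk_image_of_strictMonoOn hf ha]
  have hcard : (u.relabel f).ind.card = u.ind.card := by
    rw [ind_relabel, Finset.card_image_of_injOn hf.injOn]
  have hS : (u.relabel f).S.image (rk (u.relabel f).ind) = u.S.image (rk u.ind) := by
    change (u.S.image f).image _ = _
    rw [Finset.image_image]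
    exact Finset.image_congr fun a ha => hrk a (Finset.mem_union_left _ ha)
  have hlen : (u.relabel f).w.length = u.w.length := List.length_map ..
  have hw : ∀ t ∈ Finset.range u.w.length,
      rk (u.relabel f).ind ((u.relabel f).w.getD t 0) = rk u.ind (u.w.getD t 0) := by
    intro t ht
    rw [Finset.mem_range] at ht
    have hmem : u.w[t] ∈ u.ind :=
      Finset.mem_union_right _ (List.mem_toFinset.2 (List.getElem_mem ht))
    rw [List.getD_eq_getElem _ _ (hlen.symm ▸ ht), List.getD_eq_getElem _ _ ht, ← hrk _ hmem]
    simp [relabel]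
  rw [scomp, scomp, hcard, hS, hlen]
  refine List.map_congr_left fun r _ => ?_
  congr 2
  exact Finset.filter_congr fun t ht => by rw [hw t ht]

end NCMon

lemma ind_sNC (i : ℕ) (u : NCMon) :
    (sNC i u).ind = u.ind.image fun a => Equiv.swap i (i + 1) a := by
  rw [sNC]
  split_ifs with h
  · exact NCMon.ind_relabel _ u
  · push Not at h
    ext a
    simp only [Finset.mem_image, Equiv.swap_apply_def]
    grind

lemma scomp_sNC (i : ℕ) (u : NCMon) : (sNC i u).scomp = u.scomp := by
  rw [sNC]
  split_ifs with h
  · exact NCMon.scomp_relabel (swap_succ_strictMonoOn h)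
  · rfl

/-- **Proposition.** Let `I` be a set supercomposition, `A ⊂ ℕ` a finite set with
`|A| = |(I_1 ∪ ⋯ ∪ I_k) \ {0}|`, and `σ ∈ S_∞` (given as a word in the adjacent
transpositions). Then the quasisymmetrizing action in noncommuting variables in
superspace satisfies `σ · A^I = σ(A)^I`: the image of the monomial `A^I` (the unique
monomial with index set `A` and set supercomposition `I`) is the monomial with index set
`σ(A)` and the same set supercomposition `I`. -/
theorem nc_quasisymmetrizing_action_on_monomials
    (I : List (Finset ℕ)) (hI : IsSSC I) (A : Finset ℕ)
    (hA: A.card = (unionNZ I).card) (u : NCMon) (huA : u.ind = A) (huI : u.scomp = I)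
    (l : List ℕ) :
    (l.foldr sNC u).ind
        = A.image (fun a => ((l.map fun i => Equiv.swap i (i + 1)).prod : Equiv.Perm ℕ) a)
      ∧ (l.foldr sNC u).scomp = I := by
  induction l with
  | nil => exact ⟨by simp [huA], huI⟩
  | cons i l ih =>
    refine ⟨?_, by rw [List.foldr_cons, scomp_sNC, ih.2]⟩
    rw [List.foldr_cons, ind_sNC, ih.1, Finset.image_image]
    simp [Function.comp_def]
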